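/- arXiv:2209.15466 — 4 statements merged into one kernel-verified Lean document; each statement's English description precedes it below -/
import Mathlib

section
/- Let m, n ≥ 1 and let Ω : ℝ^m → ℝ ∪ {+∞} be any function with Ω ≥ 0 on the non-negative orthant (possibly nonconvex). For every a ∈ △^m, b ∈ △^n and every C ∈ ℝ^{m×n} with non-negative entries, the semi-dual value equals the value of the convexified primal: S_Ω(a,b,C) = inf { ⟨T,C⟩ + Σ_{j=1}^n Ω_{b_j}**(t_j) : T ∈ ℝ^{m×n}, T1_n = a }, where Ω_{b_j}** is the biconjugate of Ω + δ_{b_j△^m} and values are taken in the extended reals. -/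
open scoped BigOperators

noncomputable section

/-- Inner product of two vectors in `ℝ^m`. -/
def dotp {m : ℕ} (s t : Fin m → ℝ) : ℝ := ∑ i, s i * t i

/-- The conjugate `Ω_b*(s) = sup_{t ∈ b△^m} ⟨s,t⟩ − Ω(t)`, valued in the extended reals. -/
def conjSimplex {m : ℕ} (Ω : (Fin m → ℝ) → EReal) (b : ℝ) (s : Fin m → ℝ) : EReal :=
  ⨆ t : {t : Fin m → ℝ // (∀ i, 0 ≤ t i) ∧ ∑ i, t i = b},
    ((dotp s t.1 : ℝ) : EReal) - Ω t.1

/-- The biconjugate `Ω_b**(t) = sup_s ⟨s,t⟩ − Ω_b*(s)`. -/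
def biconjSimplex {m : ℕ} (Ω : (Fin m → ℝ) → EReal) (b : ℝ) (t : Fin m → ℝ) : EReal :=
  ⨆ s : Fin m → ℝ, ((dotp s t : ℝ) : EReal) - conjSimplex Ω b s

/-- The semi-dual value `S_Ω(a,b,C)`. -/
def semiDualVal {m n : ℕ} (Ω : (Fin m → ℝ) → EReal) (a : Fin m → ℝ) (b : Fin n → ℝ)
    (C : Fin m → Fin n → ℝ) : EReal :=
  ⨆ α : Fin m → ℝ,
    ((dotp α a : ℝ) : EReal) - ∑ j, conjSimplex Ω (b j) (fun i => α i - C i j)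

/-- A linear functional on a subspace (the range of `D`) dominated by a finite convex function on a
finite-dimensional space extends to a dominated linear functional on the whole space. -/
theorem ConvexOn.exists_linearMap_extension {E W : Type*} [NormedAddCommGroup E] [NormedSpace ℝ E]
    [FiniteDimensional ℝ E] [AddCommGroup W] [Module ℝ W] {G : E → ℝ}
    (hG : ConvexOn ℝ Set.univ G) (D : W →ₗ[ℝ] E) (l : W →ₗ[ℝ] ℝ) (h : ∀ w, l w ≤ G (D w)) :
    ∃ L : E →ₗ[ℝ] ℝ, (∀ w, L (D w) = l w) ∧ ∀ x, L x ≤ G x := by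
  have hcont : Continuous G := continuousOn_univ.1 (hG.continuousOn isOpen_univ)
  have hopen : IsOpen {p : E × ℝ | p.1 ∈ Set.univ ∧ G p.1 < p.2} := by
    simpa using isOpen_lt (hcont.comp continuous_fst) continuous_snd
  have hdisj : Disjoint {p : E × ℝ | p.1 ∈ Set.univ ∧ G p.1 < p.2}
      ((LinearMap.range (D.prod l) : Submodule ℝ (E × ℝ)) : Set (E × ℝ)) := by
    rw [Set.disjoint_left]
    rintro p ⟨-, hp⟩ ⟨w, rfl⟩
    exact absurd (h w) (not_le.2 hp)
  obtain ⟨f, u, hfA, hfB⟩ := geometric_hahn_banach_open hG.convex_strict_epigraph hopen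
    (LinearMap.range (D.prod l)).convex hdisj
  have hB (w : W) (c : ℝ) : u ≤ c * f (D w, l w) := by
    have := hfB (c • (D w, l w)) ⟨c • w, by simp⟩
    rwa [map_smul, smul_eq_mul] at this
  have hu : u ≤ 0 := by simpa using hB 0 0
  have hB0 (w : W) : f (D w, l w) = 0 := by
    by_contra hne
    have := hB w ((u - 1) / f (D w, l w))
    rw [div_mul_cancel₀ _ hne] at this
    linarith
  have hsplit (x : E) (r : ℝ) : f (x, r) = f (x, 0) + r * f (0, 1) := by
    have : ((x, r) : E × ℝ) = (x, 0) + r • (0, 1) := by simp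
    rw [this, map_add, map_smul, smul_eq_mul]
  have hA (x : E) (r : ℝ) (hr : G x < r) : f (x, 0) + r * f (0, 1) < 0 := by
    rw [← hsplit]
    exact (hfA (x, r) ⟨Set.mem_univ _, hr⟩).trans_le hu
  have hc : f (0, 1) < 0 := by
    have h1 := hA 0 (max (G 0) 0 + 1) (by linarith [le_max_left (G 0) 0])
    have h2 : f ((0 : E), (0 : ℝ)) = 0 := map_zero f
    rw [h2, zero_add] at h1
    have h3 : 0 < max (G 0) 0 + 1 := by linarith [le_max_right (G 0) 0]
    exact neg_of_mul_neg_right h1 h3.le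
  refine ⟨(-(f (0, 1))⁻¹) • (f.toLinearMap ∘ₗ LinearMap.inl ℝ E ℝ), fun w => ?_, fun x => ?_⟩
  · have := hB0 w
    rw [hsplit] at this
    simp only [LinearMap.smul_apply, LinearMap.comp_apply, LinearMap.inl_apply, smul_eq_mul,
      ContinuousLinearMap.coe_coe]
    rw [eq_neg_of_add_eq_zero_left this, neg_mul_neg, mul_comm, mul_assoc,
      mul_inv_cancel₀ hc.ne, mul_one]
  · simp only [LinearMap.smul_apply, LinearMap.comp_apply, LinearMap.inl_apply, smul_eq_mul,
      ContinuousLinearMap.coe_coe]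
    refine le_of_forall_gt_imp_ge_of_dense fun r hr => ?_
    have := hA x r hr
    rw [neg_mul, ← div_eq_inv_mul, ← div_neg, div_le_iff₀ (by linarith)]
    linarith

theorem EReal.coe_finsetSum {ι : Type*} (s : Finset ι) (f : ι → ℝ) :
    ((∑ i ∈ s, f i : ℝ) : EReal) = ∑ i ∈ s, (f i : EReal) := by
  classical
  induction s using Finset.induction_on with
  | empty => simp
  | insert k s hk ih => rw [Finset.sum_insert hk, Finset.sum_insert hk, EReal.coe_add, ih]

theorem EReal.sum_ne_bot {ι : Type*} {s : Finset ι} {f : ι → EReal} (h : ∀ i ∈ s, f i ≠ ⊥) :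
    ∑ i ∈ s, f i ≠ ⊥ := by
  classical
  induction s using Finset.induction_on with
  | empty => simp
  | insert k s hk ih =>
    rw [Finset.sum_insert hk, EReal.add_ne_bot_iff]
    exact ⟨h k (by simp), ih fun i hi => h i (by simp [hi])⟩

/-- A bound on all the sums `∑ j, h j (u j)` bounds the sum of the suprema. -/
theorem EReal.sum_iSup_coe_le {ι U : Type*} [Nonempty U] (s : Finset ι) (h : ι → U → ℝ) (w : ℝ)
    (hw : ∀ u : ι → U, ∑ j ∈ s, h j (u j) ≤ w) :
    ∑ j ∈ s, ⨆ x, (h j x : EReal) ≤ w := by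
  classical
  induction s using Finset.induction_on generalizing w with
  | empty =>
    simpa using hw fun _ => Classical.arbitrary U
  | insert k s hk ih =>
    rw [Finset.sum_insert hk]
    refine EReal.add_le_of_forall_lt fun a' ha' b' hb' => ?_
    obtain ⟨x, hx⟩ := lt_iSup_iff.1 ha'
    have key := ih (w - h k x) fun u => by
      have := hw (Function.update u k x)
      rw [Finset.sum_insert hk, Function.update_self] at this
      have e : ∑ j ∈ s, h j (Function.update u k x j) = ∑ j ∈ s, h j (u j) :=
        Finset.sum_congr rfl fun j hj => by
          rw [Function.update_of_ne (ne_of_mem_of_not_mem hj hk)]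
      linarith
    calc a' + b' ≤ (h k x : EReal) + ((w - h k x : ℝ) : EReal) :=
          add_le_add hx.le (hb'.le.trans key)
      _ = w := by rw [← EReal.coe_add]; simp

section Conjugate

variable {m : ℕ} {Ω : (Fin m → ℝ) → EReal} {b : ℝ}

theorem dotp_add_smul (x y : ℝ) (s s' t : Fin m → ℝ) :
    dotp (x • s + y • s') t = x * dotp s t + y * dotp s' t := by
  simp only [dotp, Finset.mul_sum, ← Finset.sum_add_distrib]
  exact Finset.sum_congr rfl fun i _ => by simp; ring

theorem dotp_sub_left (s s' t : Fin m → ℝ) : dotp (s - s') t = dotp s t - dotp s' t := by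
  simp only [dotp, ← Finset.sum_sub_distrib]
  exact Finset.sum_congr rfl fun i _ => by simp; ring

theorem conjSimplex_ne_top (hΩ : ∀ t : Fin m → ℝ, (∀ i, 0 ≤ t i) → 0 ≤ Ω t)
    (s : Fin m → ℝ) : conjSimplex Ω b s ≠ ⊤ := by
  have : conjSimplex Ω b s ≤ ((∑ i, |s i| * b : ℝ) : EReal) := by
    refine iSup_le fun t => ?_
    have h1 : dotp s t.1 ≤ ∑ i, |s i| * b := by
      refine Finset.sum_le_sum fun i _ => ?_
      have h2 : t.1 i ≤ b :=
        (Finset.single_le_sum (fun i _ => t.2.1 i) (Finset.mem_univ i)).trans_eq t.2.2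
      exact mul_le_mul (le_abs_self _) h2 (t.2.1 i) (abs_nonneg _)
    calc ((dotp s t.1 : ℝ) : EReal) - Ω t.1 ≤ (dotp s t.1 : ℝ) - 0 :=
          EReal.sub_le_sub le_rfl (hΩ _ t.2.1)
      _ ≤ _ := by rw [sub_zero]; exact_mod_cast h1
  exact (this.trans_lt (EReal.coe_lt_top _)).ne

/-- The conjugate is either real-valued and convex, or identically `⊥`. -/
theorem conjSimplex_eq_bot_or_exists_convexOn (hbot : ∀ t, Ω t ≠ ⊥)
    (hΩ : ∀ t : Fin m → ℝ, (∀ i, 0 ≤ t i) → 0 ≤ Ω t) :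
    (∀ s, conjSimplex Ω b s = ⊥) ∨
      ∃ F : (Fin m → ℝ) → ℝ, (∀ s, conjSimplex Ω b s = F s) ∧ ConvexOn ℝ Set.univ F := by
  by_cases hall : ∀ t : {t : Fin m → ℝ // (∀ i, 0 ≤ t i) ∧ ∑ i, t i = b}, Ω t.1 = ⊤
  · left
    intro s
    simp [conjSimplex, hall]
  right
  push Not at hall
  obtain ⟨t₀, ht₀⟩ := hall
  have hne (s : Fin m → ℝ) : conjSimplex Ω b s ≠ ⊥ := by
    have h1 : ((dotp s t₀.1 : ℝ) : EReal) - Ω t₀.1 ≤ conjSimplex Ω b s :=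
      le_iSup (fun t : {t : Fin m → ℝ // (∀ i, 0 ≤ t i) ∧ ∑ i, t i = b} =>
        ((dotp s t.1 : ℝ) : EReal) - Ω t.1) t₀
    rw [← EReal.coe_toReal ht₀ (hbot _), ← EReal.coe_sub] at h1
    exact ((EReal.bot_lt_coe _).trans_le h1).ne'
  have hF (s : Fin m → ℝ) : conjSimplex Ω b s = (conjSimplex Ω b s).toReal :=
    (EReal.coe_toReal (conjSimplex_ne_top hΩ s) (hne s)).symm
  refine ⟨fun s => (conjSimplex Ω b s).toReal, hF, convex_univ, ?_⟩
  intro s _ s' _ x y hx hy hxy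
  rw [smul_eq_mul, smul_eq_mul, ← EReal.coe_le_coe_iff, ← hF]
  refine iSup_le fun t => ?_
  by_cases ht : Ω t.1 = ⊤
  · simp [ht]
  have hle (s : Fin m → ℝ) : dotp s t.1 - (Ω t.1).toReal ≤ (conjSimplex Ω b s).toReal := by
    rw [← EReal.coe_le_coe_iff, ← hF, EReal.coe_sub, EReal.coe_toReal ht (hbot _)]
    exact le_iSup (fun t : {t : Fin m → ℝ // (∀ i, 0 ≤ t i) ∧ ∑ i, t i = b} =>
        ((dotp s t.1 : ℝ) : EReal) - Ω t.1) t
  rw [← EReal.coe_toReal ht (hbot _), ← EReal.coe_sub, EReal.coe_le_coe_iff, dotp_add_smul]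
  have h1 := mul_le_mul_of_nonneg_left (hle s) hx
  have h2 := mul_le_mul_of_nonneg_left (hle s') hy
  have h3 : (Ω t.1).toReal = x * (Ω t.1).toReal + y * (Ω t.1).toReal := by
    rw [← add_mul, hxy, one_mul]
  linarith

end Conjugate

theorem sum_sum_mul_eq_sum_dotp {m n : ℕ} (C T : Fin m → Fin n → ℝ) :
    ∑ i, ∑ j, C i j * T i j = ∑ j, dotp (fun i => C i j) (fun i => T i j) :=
  Finset.sum_comm

theorem dotp_eq_sum_dotp {m n : ℕ} {a : Fin m → ℝ} {T : Fin m → Fin n → ℝ}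
    (hT : ∀ i, ∑ j, T i j = a i) (α : Fin m → ℝ) :
    dotp α a = ∑ j, dotp α (fun i => T i j) := by
  simp only [dotp]
  rw [Finset.sum_comm]
  exact Finset.sum_congr rfl fun i _ => by rw [← hT, Finset.mul_sum]

/-- The conjugate of a sum of finite convex functions is bounded below by an exact
infimal convolution: a transport plan attaining the bound exists. -/
theorem exists_plan_of_forall_le {m n : ℕ} {F : Fin n → (Fin m → ℝ) → ℝ}
    (hF : ∀ j, ConvexOn ℝ Set.univ (F j)) (a : Fin m → ℝ) (C : Fin m → Fin n → ℝ) (v : ℝ)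
    (hv : ∀ α : Fin m → ℝ, dotp α a - ∑ j, F j (fun i => α i - C i j) ≤ v) :
    ∃ T : Fin m → Fin n → ℝ, (∀ i, ∑ j, T i j = a i) ∧
      ∀ u : Fin n → Fin m → ℝ,
        ∑ j, (dotp (u j) (fun i => T i j) - F j (u j)) ≤ v - ∑ i, ∑ j, C i j * T i j := by
  classical
  set c : Fin n → Fin m → ℝ := fun j i => C i j with hc
  have hG : ConvexOn ℝ Set.univ
      (fun s : Fin n → Fin m → ℝ => ∑ j, F j (s j - c j) + v) := by
    refine ⟨convex_univ, fun s _ s' _ x y hx hy hxy => ?_⟩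
    have h1 : ∑ j, F j ((x • s + y • s') j - c j)
        ≤ ∑ j, (x * F j (s j - c j) + y * F j (s' j - c j)) := by
      refine Finset.sum_le_sum fun j _ => ?_
      have h2 := (hF j).2 (Set.mem_univ (s j - c j)) (Set.mem_univ (s' j - c j)) hx hy hxy
      have h3 : (x • s + y • s') j - c j = x • (s j - c j) + y • (s' j - c j) := by
        have : c j = (x + y) • c j := by rw [hxy, one_smul]
        conv_lhs => rw [this]
        simp only [Pi.add_apply, Pi.smul_apply]
        module
      rw [h3]
      exact h2
    rw [Finset.sum_add_distrib, ← Finset.mul_sum, ← Finset.mul_sum] at h1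
    have h4 : v = x * v + y * v := by rw [← add_mul, hxy, one_mul]
    simp only [smul_eq_mul]
    linarith
  let D : (Fin m → ℝ) →ₗ[ℝ] (Fin n → Fin m → ℝ) := LinearMap.pi fun _ => LinearMap.id
  let l : (Fin m → ℝ) →ₗ[ℝ] ℝ := ∑ i, a i • LinearMap.proj i
  have hl (α : Fin m → ℝ) : l α = dotp α a := by
    simp [l, dotp, mul_comm]
  obtain ⟨L, hLD, hLG⟩ := hG.exists_linearMap_extension D l fun α => by
    have := hv α
    rw [hl]
    change dotp α a ≤ ∑ j, F j (fun i => α i - C i j) + v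
    linarith
  let T : Fin m → Fin n → ℝ := fun i j => L (Pi.single j (Pi.single i 1))
  have hLT (s : Fin n → Fin m → ℝ) : L s = ∑ j, dotp (s j) (fun i => T i j) := by
    have h1 : s = ∑ j, ∑ i, s j i • (Pi.single j (Pi.single i (1 : ℝ)) : Fin n → Fin m → ℝ) := by
      ext j i
      simp [Finset.sum_apply, Pi.single_apply, ite_apply]
    conv_lhs => rw [h1]
    simp [dotp, T]
  refine ⟨T, fun i => ?_, fun u => ?_⟩
  · have h1 := hLD (Pi.single i 1)
    rw [hl, hLT] at h1
    simpa [dotp, D, Pi.single_apply] using h1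
  · have h1 := hLG (u + c)
    rw [hLT] at h1
    rw [sum_sum_mul_eq_sum_dotp, Finset.sum_sub_distrib]
    have h2 : ∑ j, dotp ((u + c) j) (fun i => T i j)
        = ∑ j, dotp (u j) (fun i => T i j) + ∑ j, dotp (c j) (fun i => T i j) := by
      rw [← Finset.sum_add_distrib]
      refine Finset.sum_congr rfl fun j _ => ?_
      simpa using dotp_add_smul 1 1 (u j) (c j) (fun i => T i j)
    simp only [Pi.add_apply, add_sub_cancel_right] at h1 h2
    linarith

/-- Primal interpretation of the semi-dual: `S_Ω(a,b,C)` equals the value of the convexified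
primal, an infimum over matrices satisfying only the row-marginal constraint `T1_n = a`,
with the regularizer on column `j` replaced by the biconjugate `Ω_{b_j}**`. -/
theorem semiDual_eq_convexified_primal {m n : ℕ} (hm : 1 ≤ m) (hn : 1 ≤ n)
    (Ω : (Fin m → ℝ) → EReal)
    (hΩbot : ∀ t, Ω t ≠ ⊥)
    (hΩnonneg : ∀ t : Fin m → ℝ, (∀ i, 0 ≤ t i) → 0 ≤ Ω t)
    (a : Fin m → ℝ) (ha : (∀ i, 0 ≤ a i) ∧ ∑ i, a i = 1)
    (b : Fin n → ℝ) (hb : (∀ j, 0 ≤ b j) ∧ ∑ j, b j = 1)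
    (C : Fin m → Fin n → ℝ) (hC : ∀ i j, 0 ≤ C i j) :
    semiDualVal Ω a b C =
      ⨅ T : {T : Fin m → Fin n → ℝ // ∀ i, ∑ j, T i j = a i},
        ((∑ i, ∑ j, C i j * T.1 i j : ℝ) : EReal)
          + ∑ j, biconjSimplex Ω (b j) (fun i => T.1 i j) := by
  rw [semiDualVal]
  by_cases hdeg : ∃ j, ∀ s, conjSimplex Ω (b j) s = ⊥
  · obtain ⟨j₀, hj₀⟩ := hdeg
    have hL (α : Fin m → ℝ) : ∑ j, conjSimplex Ω (b j) (fun i => α i - C i j) = ⊥ := by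
      rw [← Finset.add_sum_erase _ _ (Finset.mem_univ j₀), hj₀, EReal.bot_add]
    have hR (t : Fin n → Fin m → ℝ) : ∑ j, biconjSimplex Ω (b j) (t j) = ⊤ := by
      rw [← Finset.add_sum_erase _ _ (Finset.mem_univ j₀)]
      have h1 : biconjSimplex Ω (b j₀) (t j₀) = ⊤ := by
        simp [biconjSimplex, hj₀]
      rw [h1]
      refine EReal.top_add_of_ne_bot (EReal.sum_ne_bot fun j _ => ?_)
      have h2 : ((dotp 0 (t j) : ℝ) : EReal) - conjSimplex Ω (b j) 0
          ≤ biconjSimplex Ω (b j) (t j) :=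
        le_iSup (fun s => ((dotp s (t j) : ℝ) : EReal) - conjSimplex Ω (b j) s) 0
      intro h3
      rw [h3, le_bot_iff, sub_eq_add_neg] at h2
      have h4 := conjSimplex_ne_top (b := b j) hΩnonneg 0
      simp_all [EReal.add_eq_bot_iff]
    simp_rw [hL, hR fun j i => _]
    simp
  push Not at hdeg
  have hex (j : Fin n) := (conjSimplex_eq_bot_or_exists_convexOn (b := b j) hΩbot
    hΩnonneg).resolve_left fun h => (hdeg j).elim fun s hs => hs (h s)
  choose F hF hconv using hex
  have hbi (j : Fin n) (t : Fin m → ℝ) :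
      biconjSimplex Ω (b j) t = ⨆ s, ((dotp s t - F j s : ℝ) : EReal) := by
    simp only [biconjSimplex, hF, EReal.coe_sub]
  simp only [hF, hbi, ← EReal.coe_finsetSum, ← EReal.coe_sub]
  apply le_antisymm
  · refine iSup_le fun α => le_iInf fun T => ?_
    have h1 : ((∑ j, (dotp (fun i => α i - C i j) (fun i => T.1 i j)
        - F j (fun i => α i - C i j)) : ℝ) : EReal)
        ≤ ∑ j, ⨆ s, ((dotp s (fun i => T.1 i j) - F j s : ℝ) : EReal) := by
      rw [EReal.coe_finsetSum]
      exact Finset.sum_le_sum fun j _ =>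
        le_iSup (fun s => ((dotp s (fun i => T.1 i j) - F j s : ℝ) : EReal)) _
    refine le_trans (le_of_eq ?_) (add_le_add le_rfl h1)
    rw [← EReal.coe_add, EReal.coe_eq_coe_iff, sum_sum_mul_eq_sum_dotp,
      dotp_eq_sum_dotp T.2, ← Finset.sum_sub_distrib, ← Finset.sum_add_distrib]
    refine Finset.sum_congr rfl fun j _ => ?_
    have := dotp_sub_left α (fun i => C i j) (fun i => T.1 i j)
    change dotp (fun i => α i - C i j) _ = _ at this
    rw [this]
    ring
  · by_contra! hlt
    obtain ⟨v, hv, hv'⟩ := EReal.lt_iff_exists_real_btwn.1 hlt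
    obtain ⟨T, hTa, hT⟩ := exists_plan_of_forall_le hconv a C v fun α =>
      EReal.coe_le_coe_iff.1 ((le_iSup (fun α : Fin m → ℝ =>
        ((dotp α a - ∑ j, F j (fun i => α i - C i j) : ℝ) : EReal)) α).trans hv.le)
    refine hv'.not_ge (iInf_le_of_le ⟨T, hTa⟩ ?_)
    refine (add_le_add le_rfl (EReal.sum_iSup_coe_le Finset.univ
      (fun j s => dotp s (fun i => T i j) - F j s) _ hT)).trans (le_of_eq ?_)
    rw [← EReal.coe_add, EReal.coe_eq_coe_iff]
    ring

end
end

section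
/- Let m, n ≥ 1 and let Ω : ℝ^m → ℝ ∪ {+∞} be convex, lower semicontinuous, non-negative, and finite at some point of the non-negative orthant. Then strong duality holds for the regularized optimal transport problem: for every a ∈ △^m, b ∈ △^n and every C ∈ ℝ^{m×n} with non-negative entries, P_Ω(a,b,C) = D_Ω(a,b,C) = S_Ω(a,b,C). -/
open scoped BigOperators

noncomputable section

/-- The conjugate `Ω₊*(s) = sup_{t ≥ 0} ⟨s,t⟩ − Ω(t)`, valued in the extended reals. -/
def conjPlus {m : ℕ} (Ω : (Fin m → ℝ) → EReal) (s : Fin m → ℝ) : EReal :=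
  ⨆ t : {t : Fin m → ℝ // ∀ i, 0 ≤ t i}, ((dotp s t.1 : ℝ) : EReal) - Ω t.1

/-- The dual value `D_Ω(a,b,C)`. -/
def dualVal {m n : ℕ} (Ω : (Fin m → ℝ) → EReal) (a : Fin m → ℝ) (b : Fin n → ℝ)
    (C : Fin m → Fin n → ℝ) : EReal :=
  ⨆ α : Fin m → ℝ, ⨆ β : Fin n → ℝ,
    ((dotp α a : ℝ) : EReal) + ((dotp β b : ℝ) : EReal)
      - ∑ j, conjPlus Ω (fun i => α i + β j - C i j)

/-- The primal value `P_Ω(a,b,C)`, an infimum over the transportation polytope `U(a,b)`. -/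
def primalVal {m n : ℕ} (Ω : (Fin m → ℝ) → EReal) (a : Fin m → ℝ) (b : Fin n → ℝ)
    (C : Fin m → Fin n → ℝ) : EReal :=
  ⨅ T : {T : Fin m → Fin n → ℝ //
      (∀ i j, 0 ≤ T i j) ∧ (∀ i, ∑ j, T i j = a i) ∧ (∀ j, ∑ i, T i j = b j)},
    ((∑ i, ∑ j, C i j * T.1 i j : ℝ) : EReal) + ∑ j, Ω (fun i => T.1 i j)

open Filter Topology

theorem EReal.coe_finset_sum {ι : Type*} (s : Finset ι) (f : ι → ℝ) :
    ((∑ j ∈ s, f j : ℝ) : EReal) = ∑ j ∈ s, (f j : EReal) :=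
  map_sum (⟨⟨Real.toEReal, EReal.coe_zero⟩, EReal.coe_add⟩ : ℝ →+ EReal) f s

/-- The bound `∑ j ∈ s, S j ≤ M` may be tested on real numbers strictly below each term. -/
theorem EReal.sum_le_of_forall_lt {ι : Type*} (s : Finset ι) (S : ι → EReal) (M : ℝ)
    (h : ∀ c : ι → ℝ, (∀ j ∈ s, (c j : EReal) < S j) → ∑ j ∈ s, c j ≤ M) :
    ∑ j ∈ s, S j ≤ (M : EReal) := by
  classical
  induction s using Finset.induction_on generalizing M with
  | empty => simpa using h 0 (by simp)
  | insert k s hk ih =>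
    rw [Finset.sum_insert hk]
    refine EReal.add_le_of_forall_lt fun x hx y hy => ?_
    obtain ⟨c₀, hxc, hcS⟩ := EReal.lt_iff_exists_real_btwn.1 hx
    have hrest : ∑ j ∈ s, S j ≤ ((M - c₀ : ℝ) : EReal) := by
      refine ih _ fun c hc => ?_
      have hne : ∀ j ∈ s, j ≠ k := fun j hj hjk => hk (hjk ▸ hj)
      have := h (Function.update c k c₀) (fun j hj => by
        rcases Finset.mem_insert.1 hj with rfl | hj
        · simpa using hcS
        · simpa [hne j hj] using hc j hj)
      rw [Finset.sum_insert hk, Function.update_self,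
        Finset.sum_congr rfl fun j hj => Function.update_of_ne (hne j hj) _ _] at this
      linarith
    calc x + y ≤ (c₀ : EReal) + ((M - c₀ : ℝ) : EReal) :=
          add_le_add hxc.le (hy.le.trans hrest)
      _ = M := by rw [← EReal.coe_add]; congr 1; ring

section

variable {m n : ℕ}

/-- Nonnegative plans together with real upper bounds on the regularization of each column. -/
def planEpigraph (n : ℕ) (Ω : (Fin m → ℝ) → EReal) :
    Set ((Fin n → Fin m → ℝ) × (Fin n → ℝ)) :=
  {x | (∀ j i, 0 ≤ x.1 j i) ∧ ∀ j, Ω (x.1 j) ≤ (x.2 j : EReal)}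

/-- The linear map sending a plan and column bounds to both marginals and the total cost. -/
def marginalsCost (C : Fin m → Fin n → ℝ) :
    ((Fin n → Fin m → ℝ) × (Fin n → ℝ)) →ₗ[ℝ] (Fin m → ℝ) × (Fin n → ℝ) × ℝ where
  toFun x := (fun i => ∑ j, x.1 j i, fun j => ∑ i, x.1 j i,
    ∑ i, ∑ j, C i j * x.1 j i + ∑ j, x.2 j)
  map_add' x y := by
    ext <;> simp [Finset.sum_add_distrib, mul_add]
    ring
  map_smul' r x := by
    ext <;> simp [Finset.mul_sum, mul_add, mul_left_comm]

theorem isClosed_planEpigraph {Ω : (Fin m → ℝ) → EReal} (hlsc : LowerSemicontinuous Ω) :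
    IsClosed (planEpigraph n Ω) := by
  have hepi := hlsc.isClosed_epigraph
  have hset : planEpigraph n Ω = (⋂ j, ⋂ i, {x | 0 ≤ x.1 j i}) ∩
      ⋂ j, (fun x => (x.1 j, ((x.2 j : ℝ) : EReal))) ⁻¹' {p : (Fin m → ℝ) × EReal | Ω p.1 ≤ p.2} := by
    ext x
    simp [planEpigraph]
  rw [hset]
  refine (isClosed_iInter fun j => isClosed_iInter fun i =>
    isClosed_le continuous_const (by fun_prop)).inter (isClosed_iInter fun j => hepi.preimage ?_)
  exact Continuous.prodMk (by fun_prop) (continuous_coe_real_ereal.comp (by fun_prop))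

theorem convex_planEpigraph {Ω : (Fin m → ℝ) → EReal}
    (hconv : ∀ t₁ t₂ : Fin m → ℝ, ∀ θ : ℝ, 0 ≤ θ → θ ≤ 1 →
      Ω (θ • t₁ + (1 - θ) • t₂) ≤ (θ : EReal) * Ω t₁ + ((1 - θ : ℝ) : EReal) * Ω t₂) :
    Convex ℝ (planEpigraph n Ω) := by
  rintro x ⟨hx, hxΩ⟩ y ⟨hy, hyΩ⟩ p q hp hq hpq
  obtain rfl : q = 1 - p := by linarith
  refine ⟨fun j i => ?_, fun j => ?_⟩
  · exact add_nonneg (mul_nonneg hp (hx j i)) (mul_nonneg hq (hy j i))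
  · refine (hconv (x.1 j) (y.1 j) p hp (by linarith)).trans ?_
    calc (p : EReal) * Ω (x.1 j) + ((1 - p : ℝ) : EReal) * Ω (y.1 j)
        ≤ (p : EReal) * (x.2 j : EReal) + ((1 - p : ℝ) : EReal) * (y.2 j : EReal) :=
          add_le_add (mul_le_mul_of_nonneg_left (hxΩ j) (by exact_mod_cast hp))
            (mul_le_mul_of_nonneg_left (hyΩ j) (by exact_mod_cast hq))
      _ = _ := by norm_cast

/-- The epigraph of the value function of the primal problem is closed. -/
theorem isClosed_image_marginalsCost {Ω : (Fin m → ℝ) → EReal} (hlsc : LowerSemicontinuous Ω)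
    (hΩ : ∀ t, 0 ≤ Ω t) {C : Fin m → Fin n → ℝ} (hC : ∀ i j, 0 ≤ C i j) :
    IsClosed (marginalsCost C '' planEpigraph n Ω) := by
  refine IsSeqClosed.isClosed fun x z hx hz => ?_
  obtain ⟨R, hR⟩ := (Metric.isBounded_range_of_tendsto x hz).exists_norm_le
  let B : Set ((Fin n → Fin m → ℝ) × (Fin n → ℝ)) := Set.Icc 0 (fun _ _ => R, fun _ => R)
  have hcompact : IsCompact (marginalsCost C '' (planEpigraph n Ω ∩ B)) :=
    (isCompact_Icc.inter_left (isClosed_planEpigraph hlsc)).image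
      (marginalsCost C).continuous_of_finiteDimensional
  refine Set.image_mono Set.inter_subset_left
    (hcompact.isClosed.mem_of_tendsto hz (Eventually.of_forall fun k => ?_))
  obtain ⟨y, hy, hyx⟩ := hx k
  have hw : ∀ j, 0 ≤ y.2 j := fun j => by exact_mod_cast (hΩ _).trans (hy.2 j)
  have hnorm : ‖x k‖ ≤ R := hR _ ⟨k, rfl⟩
  rw [← hyx] at hnorm
  refine ⟨y, ⟨hy, ⟨⟨fun j i => hy.1 j i, hw⟩, ⟨fun j i => ?_, fun j => ?_⟩⟩⟩, hyx⟩
  · calc y.1 j i ≤ ∑ j, y.1 j i :=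
          Finset.single_le_sum (f := fun j => y.1 j i) (fun j _ => hy.1 j i) (Finset.mem_univ j)
      _ = (marginalsCost C y).1 i := rfl
      _ ≤ ‖(marginalsCost C y).1 i‖ := Real.le_norm_self _
      _ ≤ ‖(marginalsCost C y).1‖ := norm_le_pi_norm _ i
      _ ≤ R := (norm_fst_le _).trans hnorm
  · have hcost : 0 ≤ ∑ i, ∑ j, C i j * y.1 j i := Finset.sum_nonneg fun i _ =>
      Finset.sum_nonneg fun j _ => mul_nonneg (hC i j) (hy.1 j i)
    calc y.2 j ≤ ∑ j, y.2 j := Finset.single_le_sum (fun j _ => hw j) (Finset.mem_univ j)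
      _ ≤ ∑ i, ∑ j, C i j * y.1 j i + ∑ j, y.2 j := le_add_of_nonneg_left hcost
      _ = (marginalsCost C y).2.2 := rfl
      _ ≤ ‖(marginalsCost C y).2.2‖ := Real.le_norm_self _
      _ ≤ R := ((norm_snd_le _).trans (norm_snd_le _)).trans hnorm

/-- Coordinates of a continuous linear functional on `ℝ^m × ℝ^n × ℝ`. -/
theorem exists_dotp_eq (f : StrongDual ℝ ((Fin m → ℝ) × (Fin n → ℝ) × ℝ)) :
    ∃ (p : Fin m → ℝ) (q : Fin n → ℝ) (κ : ℝ),
      ∀ a b y, f (a, b, y) = dotp p a + dotp q b + κ * y := by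
  refine ⟨fun i => f (Pi.single i 1, 0, 0), fun j => f (0, Pi.single j 1, 0), f (0, 0, 1),
    fun a b y => ?_⟩
  have hsplit : (a, b, y) = ∑ i, a i • ((Pi.single i 1, 0, 0) : (Fin m → ℝ) × (Fin n → ℝ) × ℝ)
      + ∑ j, b j • ((0, Pi.single j 1, 0) : (Fin m → ℝ) × (Fin n → ℝ) × ℝ)
      + y • ((0, 0, 1) : (Fin m → ℝ) × (Fin n → ℝ) × ℝ) := by
    ext <;> simp [Prod.fst_sum, Prod.snd_sum, Finset.sum_apply, Pi.single_apply]
  rw [hsplit]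
  simp only [map_add, map_sum, map_smul, smul_eq_mul, dotp, mul_comm]

/-- Below the primal value there is a non-vertical affine functional separating the target
marginals from the epigraph of the value function. -/
theorem exists_affine_minorant (hn : 1 ≤ n) {Ω : (Fin m → ℝ) → EReal}
    (hconv : ∀ t₁ t₂ : Fin m → ℝ, ∀ θ : ℝ, 0 ≤ θ → θ ≤ 1 →
      Ω (θ • t₁ + (1 - θ) • t₂) ≤ (θ : EReal) * Ω t₁ + ((1 - θ : ℝ) : EReal) * Ω t₂)
    (hlsc : LowerSemicontinuous Ω) (hΩ : ∀ t, 0 ≤ Ω t)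
    (hfin : ∃ t : Fin m → ℝ, (∀ i, 0 ≤ t i) ∧ Ω t ≠ ⊤)
    {a : Fin m → ℝ} {b : Fin n → ℝ} {C : Fin m → Fin n → ℝ} (hC : ∀ i j, 0 ≤ C i j)
    {r : ℝ} (hr : (r : EReal) < primalVal Ω a b C) :
    ∃ (α : Fin m → ℝ) (β : Fin n → ℝ) (u : ℝ), r ≤ dotp α a + dotp β b + u ∧
      ∀ x ∈ planEpigraph n Ω, dotp α (marginalsCost C x).1 + dotp β (marginalsCost C x).2.1 + u
        ≤ (marginalsCost C x).2.2 := by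
  have hnotin : (a, b, r) ∉ marginalsCost C '' planEpigraph n Ω := by
    rintro ⟨x, hx, hxe⟩
    refine hr.not_ge ?_
    have h₁ : (fun i => ∑ j, x.1 j i) = a := congrArg Prod.fst hxe
    have h₂ : (fun j => ∑ i, x.1 j i) = b := congrArg (fun z => z.2.1) hxe
    have h₃ : ∑ i, ∑ j, C i j * x.1 j i + ∑ j, x.2 j = r := congrArg (fun z => z.2.2) hxe
    refine (iInf_le _ ⟨fun i j => x.1 j i, fun i j => hx.1 j i, congrFun h₁, congrFun h₂⟩).trans ?_
    rw [← h₃, EReal.coe_add, EReal.coe_finset_sum _ x.2]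
    exact add_le_add le_rfl (Finset.sum_le_sum fun j _ => hx.2 j)
  obtain ⟨f, u, hu, hsep⟩ := geometric_hahn_banach_point_closed
    ((convex_planEpigraph hconv).linear_image (marginalsCost C))
    (isClosed_image_marginalsCost hlsc hΩ hC) hnotin
  obtain ⟨p, q, κ, hf⟩ := exists_dotp_eq f
  rw [hf] at hu
  replace hsep : ∀ x ∈ planEpigraph n Ω, u < dotp p (marginalsCost C x).1
      + dotp q (marginalsCost C x).2.1 + κ * (marginalsCost C x).2.2 := fun x hx => by
    rw [← hf]; exact hsep _ ⟨x, hx, rfl⟩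
  have hnonneg : ∀ x ∈ planEpigraph n Ω, 0 ≤ (marginalsCost C x).2.2 := fun x hx =>
    add_nonneg (Finset.sum_nonneg fun i _ =>
      Finset.sum_nonneg fun j _ => mul_nonneg (hC i j) (hx.1 j i))
      (Finset.sum_nonneg fun j _ => by exact_mod_cast (hΩ _).trans (hx.2 j))
  have hκ : 0 ≤ κ := by
    obtain ⟨t, ht, htΩ⟩ := hfin
    by_contra! hneg
    let j₀ : Fin n := ⟨0, hn⟩
    let x : (Fin n → Fin m → ℝ) × (Fin n → ℝ) := (fun _ => t, fun _ => (Ω t).toReal)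
    have hray : ∀ s : ℝ, 0 ≤ s → u < dotp p (marginalsCost C x).1
        + dotp q (marginalsCost C x).2.1 + κ * ((marginalsCost C x).2.2 + s) := by
      intro s hs
      have hmem : (x.1, x.2 + Pi.single j₀ s) ∈ planEpigraph n Ω := by
        have hsingle : (0 : Fin n → ℝ) ≤ Pi.single j₀ s := Pi.single_nonneg.2 hs
        refine ⟨fun _ => ht, fun j => (EReal.le_coe_toReal htΩ).trans ?_⟩
        exact EReal.coe_le_coe_iff.2 (le_add_of_nonneg_right (hsingle j))
      have hcost : (marginalsCost C (x.1, x.2 + Pi.single j₀ s)).2.2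
          = (marginalsCost C x).2.2 + s := by
        simp [marginalsCost, Finset.sum_add_distrib, add_assoc]
      have := hsep _ hmem
      rwa [hcost] at this
    set A := dotp p (marginalsCost C x).1 + dotp q (marginalsCost C x).2.1
      + κ * (marginalsCost C x).2.2 with hA
    have h0 := hray 0 le_rfl
    have hpos : 0 ≤ (A - u) / (-κ) := div_nonneg (by linarith) (by linarith)
    have := hray _ hpos
    have hmul : κ * ((A - u) / (-κ)) = u - A := by
      rw [div_neg, mul_neg, mul_div_cancel₀ _ hneg.ne, neg_sub]
    rw [mul_add, hmul] at this
    linarith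
  -- Tilting by a small positive slope makes the separating hyperplane non-vertical.
  obtain ⟨ε, hε, hεu⟩ : ∃ ε > 0, dotp p a + dotp q b + (κ + ε) * r < u := by
    refine ⟨(u - (dotp p a + dotp q b + κ * r)) / (|r| + 1),
      div_pos (by linarith) (by positivity), ?_⟩
    set d := u - (dotp p a + dotp q b + κ * r) with hd
    have hlt : d / (|r| + 1) * r < d := by
      rw [div_mul_eq_mul_div, div_lt_iff₀ (by positivity)]
      exact mul_lt_mul_of_pos_left (by linarith [le_abs_self r]) (by linarith)
    linarith
  have hpos : 0 < κ + ε := by linarith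
  have hdot : ∀ {k : ℕ} (s t : Fin k → ℝ),
      dotp (fun i => -(s i / (κ + ε))) t = -(dotp s t / (κ + ε)) := fun s t => by
    simp only [dotp, neg_mul, Finset.sum_neg_distrib, Finset.sum_div, div_mul_eq_mul_div]
  refine ⟨fun i => -(p i / (κ + ε)), fun j => -(q j / (κ + ε)), u / (κ + ε), ?_, fun x hx => ?_⟩
  · rw [hdot, hdot]
    have : r ≤ (u - dotp p a - dotp q b) / (κ + ε) := by
      rw [le_div_iff₀ hpos]; linarith
    calc r ≤ _ := this
      _ = _ := by ring
  · rw [hdot, hdot]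
    have h₁ := hsep x hx
    have h₂ := mul_nonneg hε.le (hnonneg x hx)
    have : (u - dotp p (marginalsCost C x).1 - dotp q (marginalsCost C x).2.1) / (κ + ε)
        ≤ (marginalsCost C x).2.2 := by
      rw [div_le_iff₀ hpos]; linarith
    calc _ = _ := by ring
      _ ≤ _ := this

theorem sum_dotp_sub_eq (C : Fin m → Fin n → ℝ) (α : Fin m → ℝ) (β : Fin n → ℝ)
    (x : (Fin n → Fin m → ℝ) × (Fin n → ℝ)) :
    ∑ j, (dotp (fun i => α i + β j - C i j) (x.1 j) - x.2 j)
      = dotp α (marginalsCost C x).1 + dotp β (marginalsCost C x).2.1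
        - (marginalsCost C x).2.2 := by
  have hα : ∑ i, ∑ j, α i * x.1 j i = ∑ j, ∑ i, α i * x.1 j i := Finset.sum_comm
  have hC : ∑ i, ∑ j, C i j * x.1 j i = ∑ j, ∑ i, C i j * x.1 j i := Finset.sum_comm
  simp only [dotp, marginalsCost, LinearMap.coe_mk, AddHom.coe_mk, Finset.mul_sum, hα, hC,
    sub_mul, add_mul, Finset.sum_sub_distrib, Finset.sum_add_distrib]
  ring

theorem primalVal_le_dualVal (hn : 1 ≤ n) {Ω : (Fin m → ℝ) → EReal}
    (hconv : ∀ t₁ t₂ : Fin m → ℝ, ∀ θ : ℝ, 0 ≤ θ → θ ≤ 1 →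
      Ω (θ • t₁ + (1 - θ) • t₂) ≤ (θ : EReal) * Ω t₁ + ((1 - θ : ℝ) : EReal) * Ω t₂)
    (hlsc : LowerSemicontinuous Ω) (hΩ : ∀ t, 0 ≤ Ω t)
    (hfin : ∃ t : Fin m → ℝ, (∀ i, 0 ≤ t i) ∧ Ω t ≠ ⊤)
    (a : Fin m → ℝ) (b : Fin n → ℝ) {C : Fin m → Fin n → ℝ} (hC : ∀ i j, 0 ≤ C i j) :
    primalVal Ω a b C ≤ dualVal Ω a b C := by
  refine EReal.ge_of_forall_gt_iff_ge.1 fun r hr => ?_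
  obtain ⟨α, β, u, hru, hmin⟩ := exists_affine_minorant hn hconv hlsc hΩ hfin hC hr
  refine le_iSup₂_of_le α β ?_
  have hsum : ∑ j, conjPlus Ω (fun i => α i + β j - C i j) ≤ ((-u : ℝ) : EReal) := by
    refine EReal.sum_le_of_forall_lt _ _ _ fun c hc => ?_
    have hex : ∀ j, ∃ t : Fin m → ℝ, ∃ w : ℝ, (∀ i, 0 ≤ t i) ∧ Ω t ≤ (w : EReal) ∧
        c j ≤ dotp (fun i => α i + β j - C i j) t - w := by
      intro j
      obtain ⟨⟨t, ht⟩, hlt⟩ := lt_iSup_iff.1 (hc j (Finset.mem_univ j))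
      have htop : Ω t ≠ ⊤ := fun h => by simp [h] at hlt
      have hbot : Ω t ≠ ⊥ := fun h => by simpa [h] using hΩ t
      refine ⟨t, (Ω t).toReal, ht, EReal.le_coe_toReal htop, ?_⟩
      change (c j : EReal) < ((dotp (fun i => α i + β j - C i j) t : ℝ) : EReal) - Ω t at hlt
      rw [← EReal.coe_toReal htop hbot, ← EReal.coe_sub] at hlt
      exact (EReal.coe_lt_coe_iff.1 hlt).le
    choose t w ht hw hcw using hex
    have h₁ := hmin (t, w) ⟨ht, hw⟩
    have h₂ := sum_dotp_sub_eq C α β (t, w)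
    have h₃ : ∑ j, c j ≤ ∑ j, (dotp (fun i => α i + β j - C i j) (t j) - w j) :=
      Finset.sum_le_sum fun j _ => hcw j
    linarith
  calc (r : EReal) ≤ ((dotp α a + dotp β b - -u : ℝ) : EReal) := by
        exact_mod_cast (by linarith : r ≤ dotp α a + dotp β b - -u)
    _ = ((dotp α a : ℝ) : EReal) + ((dotp β b : ℝ) : EReal) - ((-u : ℝ) : EReal) := by
        rw [EReal.coe_sub, EReal.coe_add]
    _ ≤ _ := EReal.sub_le_sub le_rfl hsum

theorem semiDualVal_le_primalVal {Ω : (Fin m → ℝ) → EReal} (hΩ : ∀ t, 0 ≤ Ω t)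
    (a : Fin m → ℝ) (b : Fin n → ℝ) (C : Fin m → Fin n → ℝ) :
    semiDualVal Ω a b C ≤ primalVal Ω a b C := by
  refine iSup_le fun α => le_iInf fun ⟨T, hT, hTa, hTb⟩ => ?_
  by_cases htop : ∃ j, Ω (fun i => T i j) = ⊤
  · obtain ⟨j, hj⟩ := htop
    have hsum : ∑ j, Ω (fun i => T i j) = ⊤ := top_le_iff.1 <|
      hj ▸ Finset.single_le_sum (f := fun j => Ω fun i => T i j) (fun j _ => hΩ _)
        (Finset.mem_univ j)
    simp only [hsum, EReal.coe_add_top, le_top]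
  push Not at htop
  have hω : ∀ j, Ω (fun i => T i j) = ((Ω fun i => T i j).toReal : EReal) := fun j =>
    (EReal.coe_toReal (htop j) fun h => by simpa [h] using hΩ fun i => T i j).symm
  set ω : Fin n → ℝ := fun j => (Ω fun i => T i j).toReal
  have hle : ((∑ j, (dotp (fun i => α i - C i j) (fun i => T i j) - ω j) : ℝ) : EReal)
      ≤ ∑ j, conjSimplex Ω (b j) (fun i => α i - C i j) := by
    rw [EReal.coe_finset_sum]
    refine Finset.sum_le_sum fun j _ => ?_
    refine le_trans (le_of_eq ?_) (le_iSup _ ⟨fun i => T i j, fun i => hT i j, hTb j⟩)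
    rw [EReal.coe_sub]
    exact congrArg _ (hω j).symm
  refine (EReal.sub_le_sub le_rfl hle).trans (le_of_eq ?_)
  rw [Finset.sum_congr rfl fun j _ => hω j, ← EReal.coe_finset_sum, ← EReal.coe_sub, ← EReal.coe_add]
  have hsum := sum_dotp_sub_eq C α 0 (fun j i => T i j, ω)
  have h₁ : (marginalsCost C (fun j i => T i j, ω)).1 = a := funext hTa
  have h₂ : (marginalsCost C (fun j i => T i j, ω)).2.2 = ∑ i, ∑ j, C i j * T i j + ∑ j, ω j := rfl
  simp only [Pi.zero_apply, add_zero, h₁, h₂, show dotp 0 _ = (0 : ℝ) by simp [dotp]] at hsum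
  rw [hsum]
  congr 1
  ring

theorem conjSimplex_add_le_conjPlus (Ω : (Fin m → ℝ) → EReal) (c β : ℝ) (s : Fin m → ℝ) :
    ((β * c : ℝ) : EReal) + conjSimplex Ω c s ≤ conjPlus Ω (fun i => s i + β) := by
  rw [add_comm, ← EReal.le_sub_iff_add_le (.inl (EReal.coe_ne_bot _)) (.inl (EReal.coe_ne_top _))]
  refine iSup_le fun ⟨t, ht, htc⟩ => ?_
  rw [EReal.le_sub_iff_add_le (.inl (EReal.coe_ne_bot _)) (.inl (EReal.coe_ne_top _))]
  refine le_trans (le_of_eq ?_) (le_iSup _ ⟨t, ht⟩)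
  have : dotp (fun i => s i + β) t = dotp s t + β * c := by
    simp only [dotp, add_mul, Finset.sum_add_distrib, ← Finset.mul_sum, htc]
  simp only [this, EReal.coe_add, sub_eq_add_neg]
  exact add_right_comm _ _ _

theorem dualVal_le_semiDualVal (Ω : (Fin m → ℝ) → EReal) (a : Fin m → ℝ) (b : Fin n → ℝ)
    (C : Fin m → Fin n → ℝ) : dualVal Ω a b C ≤ semiDualVal Ω a b C := by
  refine iSup₂_le fun α β => le_iSup_of_le α ?_
  have hle : ((dotp β b : ℝ) : EReal) + ∑ j, conjSimplex Ω (b j) (fun i => α i - C i j)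
      ≤ ∑ j, conjPlus Ω (fun i => α i + β j - C i j) := by
    rw [dotp, EReal.coe_finset_sum, ← Finset.sum_add_distrib]
    refine Finset.sum_le_sum fun j _ => ?_
    simpa only [sub_add_eq_add_sub] using
      conjSimplex_add_le_conjPlus Ω (b j) (β j) (fun i => α i - C i j)
  refine (EReal.sub_le_sub le_rfl hle).trans (le_of_eq ?_)
  generalize ∑ j, conjSimplex Ω (b j) (fun i => α i - C i j) = S
  induction S using EReal.rec with
  | bot => simp [← EReal.coe_add]
  | top => simp [← EReal.coe_add]
  | coe S => norm_cast; ring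

end

/-- Strong duality for OT with convex, lower semicontinuous, non-negative regularization
that is finite at some point of the non-negative orthant: `P_Ω = D_Ω = S_Ω`. -/
theorem strong_duality {m n : ℕ} (hm : 1 ≤ m) (hn : 1 ≤ n)
    (Ω : (Fin m → ℝ) → EReal)
    (hconv : ∀ t₁ t₂ : Fin m → ℝ, ∀ θ : ℝ, 0 ≤ θ → θ ≤ 1 →
      Ω (θ • t₁ + (1 - θ) • t₂) ≤ (θ : EReal) * Ω t₁ + ((1 - θ : ℝ) : EReal) * Ω t₂)
    (hlsc : LowerSemicontinuous Ω)
    (hΩnonneg : ∀ t, 0 ≤ Ω t)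
    (hfin : ∃ t : Fin m → ℝ, (∀ i, 0 ≤ t i) ∧ Ω t ≠ ⊤)
    (a : Fin m → ℝ) (ha : (∀ i, 0 ≤ a i) ∧ ∑ i, a i = 1)
    (b : Fin n → ℝ) (hb : (∀ j, 0 ≤ b j) ∧ ∑ j, b j = 1)
    (C : Fin m → Fin n → ℝ) (hC : ∀ i j, 0 ≤ C i j) :
    primalVal Ω a b C = dualVal Ω a b C ∧ dualVal Ω a b C = semiDualVal Ω a b C := by
  have hPD := primalVal_le_dualVal hn hconv hlsc hΩnonneg hfin a b hC
  have hDS := dualVal_le_semiDualVal Ω a b C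
  have hSP := semiDualVal_le_primalVal hΩnonneg a b C
  exact ⟨le_antisymm hPD (hDS.trans hSP), le_antisymm hDS (hSP.trans hPD)⟩

end
end

section
/- Let m ≥ 1, 1 ≤ k ≤ m and b > 0. Let s ∈ ℝ^m have pairwise distinct entries, let A ⊆ Fin m be the set of indices of the k largest entries of s, and let τ ∈ ℝ satisfy Σ_{i ∈ A} [s_i − τ]₊ = b. Define t* ∈ ℝ^m by t*_i = [s_i − τ]₊ for i ∈ A and t*_i = 0 otherwise. Then t* is a maximizer of ⟨s,t⟩ − ½‖t‖₂² over {t ∈ ℝ^m : t ≥ 0, Σ_i t_i = b, at most k nonzero entries}; equivalently, t* is a Euclidean projection of s onto b△^m ∩ B_k. -/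
open scoped BigOperators Classical

noncomputable section

/-- A nonnegative function whose values on `A` dominate its values off `A` has its largest sum,
among the finsets with at most `A.card` elements, on `A`. -/
theorem sum_le_sum_of_card_le_of_forall_notMem_le {ι : Type*} {A S : Finset ι} {f : ι → ℝ}
    (hf : ∀ i, 0 ≤ f i) (hA : ∀ i ∈ A, ∀ j ∉ A, f j ≤ f i) (hcard : S.card ≤ A.card) :
    ∑ i ∈ S, f i ≤ ∑ i ∈ A, f i := by
  rcases A.eq_empty_or_nonempty with rfl | hne
  · have hS : S = ∅ := by simpa using hcard
    simp [hS]
  obtain ⟨a, ha, hmin⟩ := A.exists_min_image f hne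
  have hdiff : (S \ A).card ≤ (A \ S).card := by
    have h₁ := Finset.card_sdiff_add_card_inter S A
    have h₂ := Finset.card_sdiff_add_card_inter A S
    rw [Finset.inter_comm] at h₂
    omega
  have hle : ∑ i ∈ S \ A, f i ≤ ∑ i ∈ A \ S, f i :=
    calc ∑ i ∈ S \ A, f i ≤ (S \ A).card • f a :=
          Finset.sum_le_card_nsmul _ _ _ fun i hi => hA a ha i (Finset.mem_sdiff.mp hi).2
      _ ≤ (A \ S).card • f a := nsmul_le_nsmul_left (hf a) hdiff
      _ ≤ ∑ i ∈ A \ S, f i :=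
          Finset.card_nsmul_le_sum _ _ _ fun i hi => hmin i (Finset.mem_sdiff.mp hi).1
  have h₁ := Finset.sum_inter_add_sum_sdiff S A f
  have h₂ := Finset.sum_inter_add_sum_sdiff A S f
  rw [Finset.inter_comm] at h₂
  linarith

/-- On the half-line `0 ≤ x`, the concave quadratic `c * x - x ^ 2 / 2` is at most its value at
`max c 0`. -/
theorem mul_sub_half_sq_le_half_max_sq (c : ℝ) {x : ℝ} (hx : 0 ≤ x) :
    c * x - (1 / 2) * x ^ 2 ≤ (1 / 2) * (max c 0) ^ 2 := by
  have h : c * x ≤ max c 0 * x := mul_le_mul_of_nonneg_right (le_max_left c 0) hx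
  nlinarith [sq_nonneg (max c 0 - x)]

theorem mul_max_sub_half_max_sq (c : ℝ) :
    c * max c 0 - (1 / 2) * (max c 0) ^ 2 = (1 / 2) * (max c 0) ^ 2 := by
  rcases max_cases c 0 with ⟨h, _⟩ | ⟨h, _⟩ <;> rw [h] <;> ring

/-- Subtracting a constant `τ` from the linear coefficients shifts the objective by `τ` times the
total mass. -/
theorem sum_mul_sub_half_sum_sq_eq {ι : Type*} [Fintype ι] (s t : ι → ℝ) (τ : ℝ) :
    ∑ i, s i * t i - (1 / 2) * ∑ i, (t i) ^ 2 =
      ∑ i, ((s i - τ) * t i - (1 / 2) * (t i) ^ 2) + τ * ∑ i, t i := by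
  simp only [Finset.mul_sum, ← Finset.sum_sub_distrib, ← Finset.sum_add_distrib]
  exact Finset.sum_congr rfl fun i _ => by ring

/-- The `k`-sparse projection onto the scaled simplex: for `s` with pairwise distinct
entries, `A` the set of indices of the `k` largest entries of `s`, and `τ` such that
`Σ_{i ∈ A} [s_i − τ]₊ = b`, the vector `t*` with `t*_i = [s_i − τ]₊` for `i ∈ A` and
`t*_i = 0` otherwise is feasible and maximizes `⟨s,t⟩ − ½‖t‖₂²` over `b△^m ∩ B_k`
(equivalently, it is a Euclidean projection of `s` onto `b△^m ∩ B_k`). -/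
theorem kSparse_projection_simplex {m k : ℕ} (hm : 1 ≤ m) (hk : 1 ≤ k) (hkm : k ≤ m)
    (b : ℝ) (hb : 0 < b)
    (s : Fin m → ℝ) (hs : Function.Injective s)
    (A : Finset (Fin m)) (hA : A.card = k)
    (hAtop : ∀ i ∈ A, ∀ j ∉ A, s j < s i)
    (τ : ℝ) (hτ : ∑ i ∈ A, max (s i - τ) 0 = b)
    (tstar : Fin m → ℝ)
    (htstar : tstar = fun i => if i ∈ A then max (s i - τ) 0 else 0) :
    ((∀ i, 0 ≤ tstar i) ∧ (∑ i, tstar i = b) ∧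
        (Finset.univ.filter (fun i => tstar i ≠ 0)).card ≤ k) ∧
      ∀ t : Fin m → ℝ, (∀ i, 0 ≤ t i) → (∑ i, t i = b) →
        (Finset.univ.filter (fun i => t i ≠ 0)).card ≤ k →
        ∑ i, s i * t i - (1 / 2) * ∑ i, (t i) ^ 2 ≤
          ∑ i, s i * tstar i - (1 / 2) * ∑ i, (tstar i) ^ 2 := by
  have hsum : ∑ i, tstar i = b := by
    rw [htstar, Finset.sum_ite_mem, Finset.univ_inter, hτ]
  refine ⟨⟨fun i => ?_, hsum, ?_⟩, fun t ht htsum htcard => ?_⟩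
  · rw [htstar]
    dsimp only
    split_ifs
    exacts [le_max_right _ _, le_rfl]
  · rw [← hA]
    refine Finset.card_le_card fun i hi => ?_
    by_contra hiA
    simp [htstar, hiA] at hi
  rw [sum_mul_sub_half_sum_sq_eq s t τ, sum_mul_sub_half_sum_sq_eq s tstar τ, htsum, hsum]
  have hstar : ∑ i, ((s i - τ) * tstar i - (1 / 2) * (tstar i) ^ 2) =
      ∑ i ∈ A, (1 / 2) * (max (s i - τ) 0) ^ 2 := by
    rw [← Finset.univ_inter A, ← Finset.sum_ite_mem]
    refine Finset.sum_congr rfl fun i _ => ?_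
    by_cases hi : i ∈ A
    · simpa only [htstar, if_pos hi] using mul_max_sub_half_max_sq (s i - τ)
    · simp [htstar, hi]
  have hsupp : ∑ i, ((s i - τ) * t i - (1 / 2) * (t i) ^ 2) ≤
      ∑ i ∈ Finset.univ.filter (fun i => t i ≠ 0), (1 / 2) * (max (s i - τ) 0) ^ 2 := by
    rw [Finset.sum_filter]
    refine Finset.sum_le_sum fun i _ => ?_
    split_ifs with hi
    · exact mul_sub_half_sq_le_half_max_sq _ (ht i)
    · simp [not_not.mp hi]
  have htop : ∑ i ∈ Finset.univ.filter (fun i => t i ≠ 0), (1 / 2) * (max (s i - τ) 0) ^ 2 ≤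
      ∑ i ∈ A, (1 / 2) * (max (s i - τ) 0) ^ 2 := by
    refine sum_le_sum_of_card_le_of_forall_notMem_le (fun i => by positivity)
      (fun i hi j hj => ?_) (htcard.trans hA.ge)
    have := hAtop i hi j hj
    gcongr
  linarith

end
end

section
/- Let m ≥ 1 and 1 ≤ k ≤ m. The convex conjugate of the squared k-support norm Ψ is half the sum of the k largest squared entries: for every s ∈ ℝ^m, Ψ*(s) := sup_{t ∈ ℝ^m} ⟨s,t⟩ − Ψ(t) = ½ · max_{A ⊆ Fin m, |A| = k} Σ_{i ∈ A} s_i². -/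
open scoped BigOperators Classical

noncomputable section

/-- The squared `k`-support norm
`Ψ(t) = ½ · inf { Σ_i t_i²/λ_i : λ ∈ ℝ^m, 0 < λ_i ≤ 1, Σ_i λ_i = k }`. -/
def Psi (m k : ℕ) (t : Fin m → ℝ) : ℝ :=
  (1 / 2) * sInf {v : ℝ | ∃ lam : Fin m → ℝ,
    (∀ i, 0 < lam i ∧ lam i ≤ 1) ∧ (∑ i, lam i) = (k : ℝ) ∧
    v = ∑ i, (t i) ^ 2 / lam i}

/-- The sum of the `k` largest entries of a vector `u ∈ ℝ^m` (for `k ≤ m`). -/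
def kLargestSum {m : ℕ} (k : ℕ) (hkm : k ≤ m) (u : Fin m → ℝ) : ℝ :=
  (Finset.powersetCard k (Finset.univ : Finset (Fin m))).sup'
    (Finset.powersetCard_nonempty.mpr (by simpa using hkm))
    (fun A => ∑ i ∈ A, u i)

/-- Weights in `[0, 1]` of total mass `k` give at most the sum of the `k` largest entries. -/
theorem sum_mul_le_kLargestSum {m k : ℕ} (hk : 1 ≤ k) (hkm : k ≤ m) (u lam : Fin m → ℝ)
    (hlam : ∀ i, 0 ≤ lam i ∧ lam i ≤ 1) (hsum : ∑ i, lam i = (k : ℝ)) :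
    ∑ i, lam i * u i ≤ kLargestSum k hkm u := by
  have hne : (Finset.powersetCard k (Finset.univ : Finset (Fin m))).Nonempty :=
    Finset.powersetCard_nonempty.mpr (by simpa using hkm)
  obtain ⟨A, hA, hAmax⟩ := Finset.exists_max_image _ (fun A => ∑ i ∈ A, u i) hne
  have hAcard : A.card = k := (Finset.mem_powersetCard.mp hA).2
  obtain ⟨p, hpA, hp⟩ := Finset.exists_min_image A u (Finset.card_pos.mp (by omega))
  have hout : ∀ j, j ∉ A → u j ≤ u p := by
    intro j hj
    have hj' : j ∉ A.erase p := fun h => hj (Finset.mem_of_mem_erase h)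
    have h := hAmax (insert j (A.erase p)) (Finset.mem_powersetCard.mpr
      ⟨Finset.subset_univ _, by
        rw [Finset.card_insert_of_notMem hj', Finset.card_erase_of_mem hpA]; omega⟩)
    simp only [Finset.sum_insert hj'] at h
    linarith [Finset.add_sum_erase A u hpA]
  have hterm : ∀ i, (lam i - if i ∈ A then 1 else 0) * (u i - u p) ≤ 0 := by
    intro i
    by_cases hi : i ∈ A
    · simp only [hi, if_true]
      exact mul_nonpos_of_nonpos_of_nonneg (by linarith [(hlam i).2]) (by linarith [hp i hi])
    · simp only [hi, if_false]
      exact mul_nonpos_of_nonneg_of_nonpos (by linarith [(hlam i).1]) (by linarith [hout i hi])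
  have hind : ∑ i, (if i ∈ A then (1 : ℝ) else 0) = k := by simp [hAcard]
  have hindu : ∑ i, (if i ∈ A then (1 : ℝ) else 0) * u i = ∑ i ∈ A, u i := by simp
  have htot := Finset.sum_nonpos fun i (_ : i ∈ Finset.univ) => hterm i
  simp only [mul_sub, sub_mul, Finset.sum_sub_distrib, ← Finset.sum_mul, hind, hindu, hsum] at htot
  calc ∑ i, lam i * u i ≤ ∑ i ∈ A, u i := by linarith
    _ ≤ kLargestSum k hkm u := Finset.le_sup' (fun A => ∑ i ∈ A, u i) hA

/-- Every admissible weight vector gives an upper bound on `Psi`. -/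
theorem Psi_le {m k : ℕ} (t lam : Fin m → ℝ) (hlam : ∀ i, 0 < lam i ∧ lam i ≤ 1)
    (hsum : ∑ i, lam i = (k : ℝ)) : Psi m k t ≤ (1 / 2) * ∑ i, t i ^ 2 / lam i := by
  refine mul_le_mul_of_nonneg_left (csInf_le ⟨0, ?_⟩ ⟨lam, hlam, hsum, rfl⟩) (by norm_num)
  rintro _ ⟨mu, hmu, -, rfl⟩
  exact Finset.sum_nonneg fun i _ => div_nonneg (sq_nonneg _) (hmu i).1.le

/-- The uniform weights `k / m` are admissible. -/
theorem uniform_weights {m k : ℕ} (hk : 1 ≤ k) (hkm : k ≤ m) :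
    0 < (k / m : ℝ) ∧ (k / m : ℝ) ≤ 1 ∧ ∑ _i : Fin m, (k / m : ℝ) = k := by
  have hk0 : (0 : ℝ) < k := by exact_mod_cast hk
  have hkm' : (k : ℝ) ≤ m := by exact_mod_cast hkm
  have hm0 : (0 : ℝ) < m := hk0.trans_le hkm'
  refine ⟨div_pos hk0 hm0, (div_le_one hm0).mpr hkm', ?_⟩
  simp only [Finset.sum_const, Finset.card_univ, Fintype.card_fin, nsmul_eq_mul]
  field_simp

/-- The Fenchel–Young inequality for `Psi`. -/
theorem sum_mul_sub_Psi_le {m k : ℕ} (hk : 1 ≤ k) (hkm : k ≤ m) (s t : Fin m → ℝ) :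
    ∑ i, s i * t i - Psi m k t ≤ (1 / 2) * kLargestSum k hkm (fun i => s i ^ 2) := by
  obtain ⟨h0, h1, hs⟩ := uniform_weights hk hkm
  have hinf : 2 * ∑ i, s i * t i - kLargestSum k hkm (fun i => s i ^ 2) ≤
      sInf {v : ℝ | ∃ lam : Fin m → ℝ, (∀ i, 0 < lam i ∧ lam i ≤ 1) ∧
        (∑ i, lam i) = (k : ℝ) ∧ v = ∑ i, (t i) ^ 2 / lam i} := by
    refine le_csInf ⟨_, fun _ => k / m, fun _ => ⟨h0, h1⟩, hs, rfl⟩ ?_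
    rintro _ ⟨lam, hlam, hsum, rfl⟩
    have hle := sum_mul_le_kLargestSum hk hkm (fun i => s i ^ 2) lam
      (fun i => ⟨(hlam i).1.le, (hlam i).2⟩) hsum
    have hyoung : ∑ i, 2 * (s i * t i) ≤ ∑ i, (lam i * s i ^ 2 + t i ^ 2 / lam i) := by
      refine Finset.sum_le_sum fun i _ => ?_
      have hpos := (hlam i).1
      have hsq : lam i * s i ^ 2 + t i ^ 2 / lam i - 2 * (s i * t i) =
          (lam i * s i - t i) ^ 2 / lam i := by
        field_simp
        ring
      linarith [div_nonneg (sq_nonneg (lam i * s i - t i)) hpos.le]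
    rw [← Finset.mul_sum, Finset.sum_add_distrib] at hyoung
    linarith
  unfold Psi
  linarith

/-- Scaling `s` by admissible weights bounds the supremum defining the conjugate from below. -/
theorem half_sum_le_sum_mul_sub_Psi {m k : ℕ} (s lam : Fin m → ℝ)
    (hlam : ∀ i, 0 < lam i ∧ lam i ≤ 1) (hsum : ∑ i, lam i = (k : ℝ)) :
    (1 / 2) * ∑ i, lam i * s i ^ 2 ≤
      ∑ i, s i * (lam i * s i) - Psi m k (fun i => lam i * s i) := by
  have h := Psi_le (fun i => lam i * s i) lam hlam hsum
  have h₁ : ∑ i, (lam i * s i) ^ 2 / lam i = ∑ i, lam i * s i ^ 2 :=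
    Finset.sum_congr rfl fun i _ => by
      have := (hlam i).1.ne'
      field_simp
  have h₂ : ∑ i, s i * (lam i * s i) = ∑ i, lam i * s i ^ 2 :=
    Finset.sum_congr rfl fun i _ => by ring
  rw [h₁] at h
  linarith

/-- The convex conjugate of the squared `k`-support norm,
`Ψ*(s) = sup_t ⟨s,t⟩ − Ψ(t)`, equals half the sum of the `k` largest squared entries. -/
theorem Psi_conjugate {m k : ℕ} (hm : 1 ≤ m) (hk : 1 ≤ k) (hkm : k ≤ m) (s : Fin m → ℝ) :
    IsLUB {v : ℝ | ∃ t : Fin m → ℝ, v = ∑ i, s i * t i - Psi m k t}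
      ((1 / 2) * kLargestSum k hkm (fun i => (s i) ^ 2)) := by
  refine ⟨?_, fun b hb => ?_⟩
  · rintro _ ⟨t, rfl⟩
    exact sum_mul_sub_Psi_le hk hkm s t
  obtain ⟨h0, h1, hs⟩ := uniform_weights hk hkm
  obtain ⟨A, hA, hAeq⟩ := Finset.exists_mem_eq_sup'
    (Finset.powersetCard_nonempty.mpr (by simpa using hkm) :
      (Finset.powersetCard k (Finset.univ : Finset (Fin m))).Nonempty)
    (fun A => ∑ i ∈ A, s i ^ 2)
  have hAcard : A.card = k := (Finset.mem_powersetCard.mp hA).2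
  unfold kLargestSum
  rw [hAeq]
  have hind : ∑ i, (if i ∈ A then (1 : ℝ) else 0) = k := by simp [hAcard]
  have hscaled : ∀ c : ℝ, 0 < c → c < 1 → c * ((1 / 2) * ∑ i ∈ A, s i ^ 2) ≤ b := by
    intro c hc0 hc1
    let lam : Fin m → ℝ := fun i => c * (if i ∈ A then 1 else 0) + (1 - c) * (k / m)
    have hpos : 0 < (1 - c) * (k / m : ℝ) := mul_pos (by linarith) h0
    have hle : (1 - c) * (k / m : ℝ) ≤ 1 - c := mul_le_of_le_one_right (by linarith) h1
    have hlam : ∀ i, 0 < lam i ∧ lam i ≤ 1 := by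
      intro i
      by_cases hi : i ∈ A <;> simp only [lam, hi, if_true, if_false] <;>
        constructor <;> linarith
    have hsum : ∑ i, lam i = (k : ℝ) := by
      simp only [lam, Finset.sum_add_distrib, ← Finset.mul_sum, hind, hs]
      ring
    have hb' := (half_sum_le_sum_mul_sub_Psi s lam hlam hsum).trans (hb ⟨_, rfl⟩)
    have hcA : c * ∑ i ∈ A, s i ^ 2 ≤ ∑ i, lam i * s i ^ 2 := by
      calc c * ∑ i ∈ A, s i ^ 2 = ∑ i, c * (if i ∈ A then 1 else 0) * s i ^ 2 := by
            simp [Finset.mul_sum]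
        _ ≤ ∑ i, lam i * s i ^ 2 := Finset.sum_le_sum fun i _ =>
            mul_le_mul_of_nonneg_right (le_add_of_nonneg_right hpos.le) (sq_nonneg _)
    linarith
  have hS0 : 0 ≤ (1 / 2) * ∑ i ∈ A, s i ^ 2 := by positivity
  generalize (1 / 2) * ∑ i ∈ A, s i ^ 2 = S at hscaled hS0 ⊢
  by_contra! hlt
  have hb0 : 0 ≤ b := by linarith [hscaled (1 / 2) (by norm_num) (by norm_num)]
  have hS : 0 < S := by linarith
  have h := hscaled ((b + S) / (2 * S)) (by positivity)
    ((div_lt_one (by positivity)).mpr (by linarith))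
  have hmul : (b + S) / (2 * S) * S = (b + S) / 2 := by field_simp
  linarith

end
end
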